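/- Let x_1, …, x_n ∈ ℝ^d, let F be a finite set of functions f : ℝ^d → ℝ, and let μ be a probability measure on F. Let φ(t) = (2π)^{-1/2} exp(−t²/2) be the standard Gaussian density, p₀(y) = Π_{i=1}^n φ(y_i), p_f(y) = Π_{i=1}^n φ( y_i − f(x_i) ), and p₁(y) = Σ_{f ∈ F} μ(f) p_f(y) for y ∈ ℝⁿ. Then ∫_{ℝⁿ} ( p₁(y)/p₀(y) )² p₀(y) dy = Σ_{f, f' ∈ F} μ(f) μ(f') exp( Σ_{i=1}^n f(x_i) f'(x_i) ). -/

import Mathlib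

open Real Set MeasureTheory

/-- The standard Gaussian density `φ(t) = (2π)^{-1/2} e^{−t²/2}`. -/
noncomputable def gaussD (t : ℝ) : ℝ := (Real.sqrt (2 * Real.pi))⁻¹ * Real.exp (-(t ^ 2) / 2)

theorem gaussD_pos (t : ℝ) : 0 < gaussD t := by
  unfold gaussD
  positivity

theorem gaussD_sub_eq_gaussianPDFReal (a t : ℝ) :
    gaussD (t - a) = ProbabilityTheory.gaussianPDFReal a 1 t := by
  simp [gaussD, ProbabilityTheory.gaussianPDFReal]

theorem integrable_gaussD_sub (a : ℝ) : Integrable fun t => gaussD (t - a) := by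
  simpa only [gaussD_sub_eq_gaussianPDFReal] using
    ProbabilityTheory.integrable_gaussianPDFReal a 1

theorem integral_gaussD_sub (a : ℝ) : ∫ t, gaussD (t - a) = 1 := by
  simpa only [gaussD_sub_eq_gaussianPDFReal] using
    ProbabilityTheory.integral_gaussianPDFReal_eq_one a one_ne_zero

/-- Completing the square for a product of two shifted Gaussian densities. -/
theorem gaussD_sub_mul_gaussD_sub (a b t : ℝ) :
    gaussD (t - a) * gaussD (t - b) = exp (a * b) * gaussD (t - (a + b)) * gaussD t := by
  have h : exp (-((t - a) ^ 2) / 2) * exp (-((t - b) ^ 2) / 2) =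
      exp (a * b) * exp (-((t - (a + b)) ^ 2) / 2) * exp (-(t ^ 2) / 2) := by
    simp only [← Real.exp_add]
    congr 1
    ring
  unfold gaussD
  linear_combination ((√(2 * π))⁻¹ ^ 2) * h

theorem prod_gaussD_sub_mul_prod_gaussD_sub {ι : Type*} [Fintype ι] (a b y : ι → ℝ) :
    (∏ i, gaussD (y i - a i)) * ∏ i, gaussD (y i - b i) =
      exp (∑ i, a i * b i) * (∏ i, gaussD (y i - (a i + b i))) * ∏ i, gaussD (y i) := by
  simp only [Real.exp_sum, ← Finset.prod_mul_distrib, gaussD_sub_mul_gaussD_sub]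

theorem integrable_prod_gaussD_sub {ι : Type*} [Fintype ι] (a : ι → ℝ) :
    Integrable fun y : ι → ℝ => ∏ i, gaussD (y i - a i) :=
  Integrable.fintype_prod (f := fun i t => gaussD (t - a i)) fun i => integrable_gaussD_sub (a i)

theorem integral_prod_gaussD_sub {ι : Type*} [Fintype ι] (a : ι → ℝ) :
    ∫ y : ι → ℝ, ∏ i, gaussD (y i - a i) = 1 := by
  rw [integral_fintype_prod_volume_eq_prod fun i t => gaussD (t - a i)]
  simp [integral_gaussD_sub]

/-- With `p₀(y) = Π_i φ(y_i)`, `p_f(y) = Π_i φ(y_i − f(x_i))` and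
`p₁ = Σ_f μ(f) p_f` for a probability measure `μ` on a finite set `F` of functions,
`∫_{ℝⁿ} (p₁/p₀)² p₀ = Σ_{f,f' ∈ F} μ(f) μ(f') exp(Σ_i f(x_i) f'(x_i))`. -/
theorem chi_square_mixture_formula (d n : ℕ) (x : Fin n → Fin d → ℝ)
    (F : Finset ((Fin d → ℝ) → ℝ)) (μ : ((Fin d → ℝ) → ℝ) → ℝ)
    (hμ0 : ∀ f ∈ F, 0 ≤ μ f) (hμ1 : ∑ f ∈ F, μ f = 1) :
    (∫ y : Fin n → ℝ,
        ((∑ f ∈ F, μ f * ∏ i, gaussD (y i - f (x i))) / (∏ i, gaussD (y i))) ^ 2 *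
          (∏ i, gaussD (y i)))
      = ∑ f ∈ F, ∑ f' ∈ F, μ f * μ f' * Real.exp (∑ i, f (x i) * f' (x i)) := by
  have expand (y : Fin n → ℝ) :
      ((∑ f ∈ F, μ f * ∏ i, gaussD (y i - f (x i))) / (∏ i, gaussD (y i))) ^ 2 *
          (∏ i, gaussD (y i)) =
        ∑ f ∈ F, ∑ f' ∈ F, μ f * μ f' * exp (∑ i, f (x i) * f' (x i)) *
          ∏ i, gaussD (y i - (f (x i) + f' (x i))) := by
    have hpos : ∏ i, gaussD (y i) ≠ 0 := (Finset.prod_pos fun i _ => gaussD_pos (y i)).ne'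
    rw [div_pow, pow_two (∏ i, gaussD (y i)), div_mul_eq_mul_div, mul_div_mul_right _ _ hpos,
      div_eq_iff hpos, pow_two, Finset.sum_mul_sum, Finset.sum_mul]
    refine Finset.sum_congr rfl fun f _ => ?_
    rw [Finset.sum_mul]
    refine Finset.sum_congr rfl fun f' _ => ?_
    linear_combination μ f * μ f' *
      prod_gaussD_sub_mul_prod_gaussD_sub (fun i => f (x i)) (fun i => f' (x i)) y
  have integrable_term (f f' : (Fin d → ℝ) → ℝ) : Integrable fun y : Fin n → ℝ =>
      μ f * μ f' * exp (∑ i, f (x i) * f' (x i)) *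
        ∏ i, gaussD (y i - (f (x i) + f' (x i))) :=
    (integrable_prod_gaussD_sub fun i => f (x i) + f' (x i)).const_mul _
  simp only [expand]
  rw [integral_finsetSum _ fun f _ => integrable_finsetSum _ fun f' _ => integrable_term f f']
  refine Finset.sum_congr rfl fun f _ => ?_
  rw [integral_finsetSum _ fun f' _ => integrable_term f f']
  refine Finset.sum_congr rfl fun f' _ => ?_
  rw [integral_const_mul, integral_prod_gaussD_sub fun i => f (x i) + f' (x i), mul_one]
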